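/- Let 3/2 < p < 2. Then there exists a weak solution ω_s of the self-similar profile problem whose continuous representative is strictly positive on [0,∞); ω_s is the unique positive weak solution; and every weak solution equals (almost everywhere) one of ω_s, −ω_s, or 0. -/

import Mathlib

open MeasureTheory Real Set

noncomputable def Kw (η : ℝ) : ℝ := Real.exp (η ^ 2 / 4)

/-- An element of the weighted Sobolev space `H¹_K(ℝ₊)`, represented by its
(absolutely) continuous representative on `[0,∞)` together with its
distributional derivative, both square integrable against the weight `K`. -/
structure H1K where
  toFun : ℝ → ℝ
  deriv' : ℝ → ℝ
  absCont : ∀ x : ℝ, 0 ≤ x → toFun x = toFun 0 + ∫ t in (0:ℝ)..x, deriv' t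
  memL2 : Integrable (fun η => (toFun η) ^ 2 * Kw η) (volume.restrict (Ioi (0:ℝ)))
  derivMemL2 : Integrable (fun η => (deriv' η) ^ 2 * Kw η) (volume.restrict (Ioi (0:ℝ)))

/-- `ω` is a weak solution of the self-similar profile problem
`−ω'' − (η/2)ω' − ω/(2(p−1)) = 0` on `(0,∞)`, `−ω'(0) + |ω|^{p−1}ω(0) = 0`. -/
def IsWeakProfile (p : ℝ) (ω : H1K) : Prop :=
  ∀ ζ : H1K,
    (∫ η in Ioi (0:ℝ),
        (ω.deriv' η * ζ.deriv' η - ω.toFun η * ζ.toFun η / (2 * (p - 1))) * Kw η)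
      + |ω.toFun 0| ^ (p - 1) * ω.toFun 0 * ζ.toFun 0 = 0


open Filter Topology

/-- Moment integrals. -/
noncomputable def Imom (a η : ℝ) : ℝ := ∫ t in Ioi (0:ℝ), t ^ a * Real.exp (-t ^ 2 - η * t)

lemma Imom_bound (η t : ℝ) : Real.exp (-t ^ 2 - η * t) ≤ Real.exp (η ^ 2 / 2) * Real.exp (-(1/2) * t ^ 2) := by
  rw [← Real.exp_add]
  apply Real.exp_le_exp.mpr
  nlinarith [sq_nonneg (t + η)]

lemma Imom_meas (a η : ℝ) : AEStronglyMeasurable (fun t : ℝ => t ^ a * Real.exp (-t ^ 2 - η * t))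
    (volume.restrict (Ioi (0:ℝ))) := by
  apply Measurable.aestronglyMeasurable
  fun_prop

lemma Imom_integrable {a : ℝ} (ha : -1 < a) (η : ℝ) :
    IntegrableOn (fun t : ℝ => t ^ a * Real.exp (-t ^ 2 - η * t)) (Ioi (0:ℝ)) := by
  have h := (integrableOn_rpow_mul_exp_neg_mul_sq (b := 1/2) (by norm_num) ha).const_mul
    (Real.exp (η ^ 2 / 2))
  refine Integrable.mono' h (Imom_meas a η) ?_
  filter_upwards [ae_restrict_mem measurableSet_Ioi] with t ht
  have ht0 : (0:ℝ) < t := ht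
  have h1 : 0 ≤ t ^ a := Real.rpow_nonneg ht0.le a
  rw [Real.norm_eq_abs, abs_of_nonneg (by positivity)]
  calc _ ≤ t ^ a * (Real.exp (η ^ 2 / 2) * Real.exp (-(1/2) * t ^ 2)) :=
        mul_le_mul_of_nonneg_left (Imom_bound η t) h1
    _ = _ := by ring

lemma Imom_pos {a : ℝ} (ha : -1 < a) (η : ℝ) : 0 < Imom a η := by
  unfold Imom
  rw [setIntegral_pos_iff_support_of_nonneg_ae]
  · have : (Function.support fun t : ℝ => t ^ a * Real.exp (-t ^ 2 - η * t)) ∩ Ioi 0 = Ioi 0 := by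
      apply Set.inter_eq_right.mpr
      intro t ht
      have ht0 : (0:ℝ) < t := ht
      have := Real.rpow_pos_of_pos ht0 a
      simp only [Function.mem_support]
      positivity
    rw [this]; simp
  · filter_upwards [ae_restrict_mem measurableSet_Ioi] with t ht
    have ht0 : (0:ℝ) < t := ht
    have := Real.rpow_pos_of_pos ht0 a
    simp only [Pi.zero_apply]
    positivity
  · exact Imom_integrable ha η

lemma Imom_hasDerivAt {a : ℝ} (ha : -1 < a) (η : ℝ) :
    HasDerivAt (Imom a) (-Imom (a + 1) η) η := by
  have hb := (integrableOn_rpow_mul_exp_neg_mul_sq (b := 1/2) (by norm_num)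
    (show -1 < a + 1 by linarith)).const_mul (Real.exp ((|η| + 1) ^ 2 / 2))
  have key := hasDerivAt_integral_of_dominated_loc_of_deriv_le (𝕜 := ℝ)
    (μ := volume.restrict (Ioi (0:ℝ)))
    (F := fun x t => t ^ a * Real.exp (-t ^ 2 - x * t))
    (F' := fun x t => -(t ^ (a + 1) * Real.exp (-t ^ 2 - x * t)))
    (x₀ := η) (Metric.ball_mem_nhds η one_pos)
    (Eventually.of_forall fun x => Imom_meas a x) (Imom_integrable ha η)
    (Imom_meas (a + 1) η).neg (bound := fun t => Real.exp ((|η| + 1) ^ 2 / 2) * (t ^ (a + 1) * Real.exp (-(1/2) * t ^ 2)))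
    ?_ hb ?_
  · have h2 := key.2
    rw [integral_neg] at h2
    exact h2
  · filter_upwards [ae_restrict_mem measurableSet_Ioi] with t ht x hx
    have ht0 : (0:ℝ) < t := ht
    have h1 : 0 ≤ t ^ (a + 1) := Real.rpow_nonneg ht0.le _
    rw [norm_neg, Real.norm_eq_abs, abs_of_nonneg (by positivity)]
    have hx1 : |x| ≤ |η| + 1 := by
      rw [Metric.mem_ball, Real.dist_eq] at hx
      have := abs_sub_abs_le_abs_sub x η
      linarith
    have hx2 : x ^ 2 ≤ (|η| + 1) ^ 2 := by
      rw [← sq_abs x]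
      exact pow_le_pow_left₀ (abs_nonneg x) hx1 2
    calc _ ≤ t ^ (a + 1) * (Real.exp (x ^ 2 / 2) * Real.exp (-(1/2) * t ^ 2)) :=
          mul_le_mul_of_nonneg_left (Imom_bound x t) h1
      _ ≤ t ^ (a + 1) * (Real.exp ((|η| + 1) ^ 2 / 2) * Real.exp (-(1/2) * t ^ 2)) := by gcongr
      _ = _ := by ring
  · filter_upwards [ae_restrict_mem measurableSet_Ioi] with t ht x hx
    have ht0 : (0:ℝ) < t := ht
    have h1 : HasDerivAt (fun x : ℝ => -t ^ 2 - x * t) (-t) x := by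
      simpa using ((hasDerivAt_id x).mul_const t).const_sub (-t ^ 2)
    refine HasDerivAt.congr_deriv ((h1.exp.const_mul (t ^ a))) ?_
    rw [Real.rpow_add_one ht0.ne']
    ring

lemma Imom_rec {a : ℝ} (ha : -1 < a) (η : ℝ) :
    2 * Imom (a + 2) η + η * Imom (a + 1) η = (a + 1) * Imom a η := by
  have hd : ∀ t ∈ Ioi (0:ℝ), HasDerivAt (fun t : ℝ => t ^ (a + 1) * Real.exp (-t ^ 2 - η * t))
      ((a + 1) * (t ^ a * Real.exp (-t ^ 2 - η * t))
        - (2 * (t ^ (a + 2) * Real.exp (-t ^ 2 - η * t))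
        + η * (t ^ (a + 1) * Real.exp (-t ^ 2 - η * t)))) t := by
    intro t ht
    have ht0 : (0:ℝ) < t := ht
    have h1 : HasDerivAt (fun t : ℝ => -t ^ 2 - η * t) (-(2 * t) - η) t := by
      have := ((hasDerivAt_pow 2 t).neg).sub ((hasDerivAt_id t).const_mul η)
      refine HasDerivAt.congr_deriv (this) ?_
      simp
    have h2 := Real.hasDerivAt_rpow_const (x := t) (p := a + 1) (Or.inl ht0.ne')
    refine HasDerivAt.congr_deriv (h2.mul h1.exp) ?_
    rw [show a + 2 = (a + 1) + 1 by ring, Real.rpow_add_one ht0.ne' (a + 1)]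
    rw [show a + 1 - 1 = a by ring]
    ring
  have i0 := Imom_integrable ha η
  have i1 := Imom_integrable (show -1 < a + 1 by linarith) η
  have i2 := Imom_integrable (show -1 < a + 2 by linarith) η
  have hint : IntegrableOn (fun t : ℝ => (a + 1) * (t ^ a * Real.exp (-t ^ 2 - η * t))
        - (2 * (t ^ (a + 2) * Real.exp (-t ^ 2 - η * t))
        + η * (t ^ (a + 1) * Real.exp (-t ^ 2 - η * t)))) (Ioi 0) :=
    (i0.const_mul _).sub ((i2.const_mul _).add (i1.const_mul _))
  have hlim := tendsto_zero_of_hasDerivAt_of_integrableOn_Ioi hd hint i1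
  have hc : ContinuousWithinAt (fun t : ℝ => t ^ (a + 1) * Real.exp (-t ^ 2 - η * t)) (Ici 0) 0 := by
    apply ContinuousAt.continuousWithinAt
    apply ContinuousAt.mul
    · exact Real.continuousAt_rpow_const _ _ (Or.inr (by linarith))
    · fun_prop
  have := integral_Ioi_of_hasDerivAt_of_tendsto hc hd hint hlim
  have e21 : IntegrableOn (fun t : ℝ => 2 * (t ^ (a + 2) * Real.exp (-t ^ 2 - η * t))
        + η * (t ^ (a + 1) * Real.exp (-t ^ 2 - η * t))) (Ioi 0) :=
    (i2.const_mul _).add (i1.const_mul _)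
  rw [integral_sub (i0.const_mul _) e21,
    integral_add (i2.const_mul _) (i1.const_mul _), integral_const_mul, integral_const_mul,
    integral_const_mul, Real.zero_rpow (by linarith)] at this
  unfold Imom
  linarith

/-- A positive decaying solution of the linear profile equation, with its flux. -/
structure DecSol (l : ℝ) (ψ F : ℝ → ℝ) : Prop where
  pos : ∀ x, 0 ≤ x → 0 < ψ x
  F0 : 0 < F 0
  der : ∀ x, HasDerivAt ψ (F x / Kw x) x
  derF : ∀ x, HasDerivAt F (-(l * (ψ x * Kw x))) x
  mem : Integrable (fun x => ψ x ^ 2 * Kw x) (volume.restrict (Ioi (0:ℝ)))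
  memF : Integrable (fun x => (F x / Kw x) ^ 2 * Kw x) (volume.restrict (Ioi (0:ℝ)))

lemma Kw_pos (x : ℝ) : 0 < Kw x := Real.exp_pos _

lemma Kw_hasDerivAt (x : ℝ) : HasDerivAt Kw (x / 2 * Kw x) x := by
  have h : HasDerivAt (fun x : ℝ => x ^ 2 / 4) (x / 2) x := by
    refine HasDerivAt.congr_deriv ((hasDerivAt_pow 2 x).div_const 4) ?_
    simp; ring
  refine HasDerivAt.congr_deriv (h.exp) ?_
  unfold Kw; ring

lemma Kw_continuous : Continuous Kw := by unfold Kw; fun_prop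

lemma gauss_dom {f : ℝ → ℝ} (hf : Continuous f) {C : ℝ}
    (hb : ∀ x, 0 ≤ x → |f x| ≤ C * (1 + x) ^ 2) :
    Integrable (fun x => (f x / Kw x) ^ 2 * Kw x) (volume.restrict (Ioi (0:ℝ))) := by
  have hC : Continuous (fun x => (f x / Kw x) ^ 2 * Kw x) := by
    have := Kw_continuous
    exact ((hf.div this fun x => (Kw_pos x).ne').pow 2).mul this
  have i0 : IntegrableOn (fun x : ℝ => x ^ (0:ℝ) * Real.exp (-(1/4) * x ^ 2)) (Ioi (0:ℝ)) :=
    integrableOn_rpow_mul_exp_neg_mul_sq (by norm_num) (by norm_num)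
  have i4 : IntegrableOn (fun x : ℝ => x ^ (4:ℝ) * Real.exp (-(1/4) * x ^ 2)) (Ioi (0:ℝ)) :=
    integrableOn_rpow_mul_exp_neg_mul_sq (by norm_num) (by norm_num)
  refine Integrable.mono' (g := fun x => C ^ 2 * 8 * (x ^ (0:ℝ) * Real.exp (-(1/4) * x ^ 2)
    + x ^ (4:ℝ) * Real.exp (-(1/4) * x ^ 2))) ((i0.add i4).const_mul _)
    hC.aestronglyMeasurable ?_
  filter_upwards [ae_restrict_mem measurableSet_Ioi] with x hx
  have hx0 : (0:ℝ) < x := hx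
  have h4 : x ^ (4:ℝ) = x ^ 4 := by exact_mod_cast Real.rpow_natCast x 4
  rw [h4, Real.rpow_zero]
  have hk : (f x / Kw x) ^ 2 * Kw x = f x ^ 2 * Real.exp (-(1/4) * x ^ 2) := by
    have : Real.exp (-(1/4) * x ^ 2) = (Kw x)⁻¹ := by
      unfold Kw; rw [← Real.exp_neg]; congr 1; ring
    rw [this]
    have := (Kw_pos x).ne'
    field_simp
  rw [hk, Real.norm_eq_abs, abs_of_nonneg (by positivity)]
  have h1 : f x ^ 2 ≤ C ^ 2 * 8 * (1 + x ^ 4) := by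
    have h2 : f x ^ 2 ≤ (C * (1 + x) ^ 2) ^ 2 := by
      rw [← sq_abs]
      exact pow_le_pow_left₀ (abs_nonneg _) (hb x hx0.le) 2
    have h3 : ((1 + x) ^ 2) ^ 2 ≤ 8 * (1 + x ^ 4) := by
      nlinarith [sq_nonneg (x - 1), sq_nonneg (x ^ 2 - 1), sq_nonneg (x^2 - x), sq_nonneg ((x-1)^2), sq_nonneg (x^2-1), sq_nonneg (x^2 - 2 * x + 1)]
    calc _ ≤ _ := h2
      _ = C ^ 2 * ((1 + x) ^ 2) ^ 2 := by ring
      _ ≤ C ^ 2 * (8 * (1 + x ^ 4)) := by gcongr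
      _ = _ := by ring
  calc _ ≤ (C ^ 2 * 8 * (1 + x ^ 4)) * Real.exp (-(1/4) * x ^ 2) := by gcongr
    _ = _ := by ring

lemma exists_decSol {l : ℝ} (h1 : 1 / 2 < l) (h2 : l < 1) : ∃ ψ F, DecSol l ψ F := by
  obtain ⟨a, ha⟩ : ∃ a, a = 1 - 2 * l := ⟨_, rfl⟩
  have ha1 : -1 < a := by linarith
  have ha0 : a < 0 := by linarith
  set k := Imom a with hk
  obtain ⟨h, hh⟩ : ∃ h : ℝ → ℝ, h = fun x => (x * Imom a x + 2 * Imom (a + 1) x) / (-a) := ⟨_, rfl⟩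
  have dk : ∀ x, HasDerivAt k (-Imom (a + 1) x) x := fun x => Imom_hasDerivAt ha1 x
  have dm : ∀ x, HasDerivAt (Imom (a + 1)) (-Imom (a + 2) x) x := fun x => by
    have := Imom_hasDerivAt (show -1 < a + 1 by linarith) x
    rwa [show a + 1 + 1 = a + 2 by ring] at this
  have dh : ∀ x, HasDerivAt h (k x) x := fun x => by
    rw [hh]
    refine HasDerivAt.congr_deriv (((((hasDerivAt_id x).mul (dk x)).add ((dm x).const_mul 2)).div_const (-a))) ?_
    have := Imom_rec ha1 x
    rw [div_eq_iff (by linarith)]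
    simp only [id]
    rw [← hk] at this
    linarith
  obtain ⟨F, hF⟩ : ∃ F : ℝ → ℝ, F = fun x => k x - x / 2 * h x := ⟨_, rfl⟩
  have dF : ∀ x, HasDerivAt F (-(l * h x)) x := fun x => by
    rw [hF]
    refine HasDerivAt.congr_deriv ((dk x).sub (((hasDerivAt_id x).div_const 2).mul (dh x))) ?_
    have : h x * (-a) = x * k x + 2 * Imom (a + 1) x := by
      rw [hh]; simp only; rw [div_mul_cancel₀ _ (by linarith)]
    have hl : l = (1 - a) / 2 := by linarith
    rw [hl]; simp only [id]; linarith
  have kpos : ∀ x, 0 < k x := fun x => Imom_pos ha1 x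
  have mpos : ∀ x, 0 < Imom (a + 1) x := fun x => Imom_pos (by linarith) x
  have hpos : ∀ x, 0 ≤ x → 0 < h x := fun x hx => by
    rw [hh]
    have := kpos x; have := mpos x
    apply div_pos _ (by linarith)
    have : 0 ≤ x * Imom a x := mul_nonneg hx (kpos x).le
    linarith
  have kanti : Antitone k := antitone_of_hasDerivAt_nonpos dk fun x => by
    have := mpos x; show -Imom (a + 1) x ≤ 0; linarith
  have hle : ∀ x, 0 ≤ x → h x ≤ h 0 + k 0 * x := by
    intro x hx
    have := (convex_Ici (0:ℝ)).image_sub_le_mul_sub_of_deriv_le (f := h) (C := k 0)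
      (fun y _ => (dh y).continuousAt.continuousWithinAt)
      (fun y _ => (dh y).differentiableAt.differentiableWithinAt)
      (fun y hy => by
        rw [interior_Ici] at hy
        rw [(dh y).deriv]; exact kanti (le_of_lt hy)) 0 self_mem_Ici x hx hx
    linarith
  have hcont : Continuous h := continuous_iff_continuousAt.mpr fun x => (dh x).continuousAt
  have Fcont : Continuous F := continuous_iff_continuousAt.mpr fun x => (dF x).continuousAt
  have h0 := hpos 0 le_rfl
  have k0 := kpos 0
  refine ⟨fun x => h x / Kw x, F, ?_, ?_, ?_, ?_, ?_, ?_⟩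
  · exact fun x hx => div_pos (hpos x hx) (Kw_pos x)
  · rw [hF]; simpa using k0
  · intro x
    have hK := (Kw_pos x).ne'
    refine HasDerivAt.congr_deriv ((dh x).div (Kw_hasDerivAt x) hK) ?_
    rw [hF]
    field_simp
  · intro x
    rw [div_mul_cancel₀ _ (Kw_pos x).ne']
    exact dF x
  · refine gauss_dom hcont (C := h 0 + k 0) fun x hx => ?_
    rw [abs_of_pos (hpos x hx)]
    have := hle x hx
    nlinarith [mul_nonneg h0.le hx, mul_nonneg k0.le hx, mul_nonneg h0.le (sq_nonneg x), mul_nonneg k0.le (sq_nonneg x)]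
  · refine gauss_dom Fcont (C := h 0 + k 0) fun x hx => ?_
    have e1 := hle x hx
    have e2 := kanti hx
    have e3 := hpos x hx
    have e4 := kpos x
    have e5 : x / 2 * h x ≤ x / 2 * (h 0 + k 0 * x) := by gcongr
    have e6 : 0 ≤ x / 2 * h x := by positivity
    rw [hF, abs_le]
    constructor <;>
    nlinarith [mul_nonneg h0.le hx, mul_nonneg k0.le hx, mul_nonneg h0.le (sq_nonneg x), mul_nonneg k0.le (sq_nonneg x)]

lemma ac_prim {u : ℝ → ℝ} {X : ℝ} (c : ℝ) (hu : IntervalIntegrable u volume 0 X) :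
    AbsolutelyContinuousOnInterval (fun x => c + ∫ t in (0:ℝ)..x, u t) 0 X := by
  have h1 : AbsolutelyContinuousOnInterval (fun _ : ℝ => c) 0 X :=
    (LipschitzWith.const c).lipschitzOnWith.absolutelyContinuousOnInterval
  have h2 := hu.absolutelyContinuousOnInterval_intervalIntegral (c := 0) (by simp)
  exact h1.add h2

lemma ibp {u v A B : ℝ → ℝ} {X : ℝ} (hX : 0 ≤ X)
    (hu : IntervalIntegrable u volume 0 X) (hv : IntervalIntegrable v volume 0 X)
    (hA : ∀ x ∈ Icc 0 X, A x = A 0 + ∫ t in (0:ℝ)..x, u t)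
    (hB : ∀ x ∈ Icc 0 X, B x = B 0 + ∫ t in (0:ℝ)..x, v t) :
    ∫ x in (0:ℝ)..X, (u x * B x + A x * v x) = A X * B X - A 0 * B 0 := by
  have h := (ac_prim (A 0) hu).integral_deriv_mul_eq_sub (ac_prim (B 0) hv)
  simp only [intervalIntegral.integral_same, add_zero] at h
  rw [← hA X (by simp [hX]), ← hB X (by simp [hX])] at h
  rw [← h]
  apply intervalIntegral.integral_congr_ae
  filter_upwards [hu.ae_hasDerivAt_integral, hv.ae_hasDerivAt_integral] with x h1 h2 hx
  have hx' : x ∈ uIcc 0 X := uIoc_subset_uIcc hx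
  have e1 := ((h1 hx' 0 (by simp)).const_add (A 0)).deriv
  have e2 := ((h2 hx' 0 (by simp)).const_add (B 0)).deriv
  rw [uIcc_of_le hX] at hx'
  rw [e1, e2, ← hA x hx', ← hB x hx']

lemma Kw_one_le (x : ℝ) : 1 ≤ Kw x := by
  unfold Kw; apply Real.one_le_exp; positivity

lemma ii_mono {u : ℝ → ℝ} {x y : ℝ} (hx : 0 ≤ x) (hxy : x ≤ y)
    (h : IntervalIntegrable u volume 0 y) : IntervalIntegrable u volume 0 x :=
  h.mono_set (by rw [uIcc_of_le hx, uIcc_of_le (hx.trans hxy)]; exact Icc_subset_Icc_right hxy)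

lemma H1K.good_or (ζ : H1K) : (∀ X, 0 ≤ X → IntervalIntegrable ζ.deriv' volume 0 X) ∨
    ζ.toFun 0 = 0 := by
  by_cases hg : ∀ X, 0 ≤ X → IntervalIntegrable ζ.deriv' volume 0 X
  · exact Or.inl hg
  right
  push Not at hg
  obtain ⟨X, hX, hn⟩ := hg
  have hc : ∀ x, X ≤ x → ζ.toFun x = ζ.toFun 0 := by
    intro x hx
    rw [ζ.absCont x (hX.trans hx), intervalIntegral.integral_undef, add_zero]
    exact fun h => hn (ii_mono hX hx h)
  have h1 : IntegrableOn (fun η => (ζ.toFun η) ^ 2 * Kw η) (Ioi X) :=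
    IntegrableOn.mono_set ζ.memL2 (Ioi_subset_Ioi hX)
  have h2 : IntegrableOn (fun _ : ℝ => ζ.toFun 0 ^ 2) (Ioi X) := by
    refine Integrable.mono' h1 aestronglyMeasurable_const ?_
    filter_upwards [ae_restrict_mem measurableSet_Ioi] with x hx
    rw [hc x (le_of_lt hx), Real.norm_eq_abs, abs_of_nonneg (by positivity)]
    nlinarith [Kw_one_le x, sq_nonneg (ζ.toFun 0)]
  rw [integrableOn_const_iff] at h2
  rcases h2 with h2 | h2
  · simpa using h2
  · simp at h2

lemma H1K.contOn (ζ : H1K) {X : ℝ} (hX : 0 ≤ X) (h : IntervalIntegrable ζ.deriv' volume 0 X) :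
    ContinuousOn ζ.toFun (Icc 0 X) := by
  have := intervalIntegral.continuousOn_primitive_interval' h (left_mem_uIcc)
  rw [uIcc_of_le hX] at this
  refine ((continuousOn_const (c := ζ.toFun 0)).add this).congr fun x hx => ?_
  exact ζ.absCont x hx.1

lemma H1K.aesm (ζ : H1K) : AEStronglyMeasurable ζ.toFun (volume.restrict (Ioi (0:ℝ))) := by
  let S := {x : ℝ | 0 ≤ x ∧ IntervalIntegrable ζ.deriv' volume 0 x}
  have hoc : S.OrdConnected := by
    refine ⟨fun x hx y hy z hz => ?_⟩
    exact ⟨hx.1.trans hz.1, ii_mono (hx.1.trans hz.1) hz.2 hy.2⟩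
  have hSm : MeasurableSet S := hoc.measurableSet
  have hSc : ContinuousOn ζ.toFun S := by
    intro x hx
    by_cases hy : ∃ y ∈ S, x < y
    · obtain ⟨y, hy, hxy⟩ := hy
      have h1 := ζ.contOn hy.1 hy.2 x ⟨hx.1, hxy.le⟩
      refine h1.mono_of_mem_nhdsWithin ?_
      filter_upwards [self_mem_nhdsWithin, mem_nhdsWithin_of_mem_nhds (Iio_mem_nhds hxy)] with z hz hz2
      exact ⟨hz.1, le_of_lt hz2⟩
    · push Not at hy
      exact (ζ.contOn hx.1 hx.2 x ⟨hx.1, le_rfl⟩).mono fun z hz => ⟨hz.1, hy z hz⟩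
  have h1 : AEStronglyMeasurable ζ.toFun (volume.restrict S) := hSc.aestronglyMeasurable hSm
  have h2 : AEStronglyMeasurable ζ.toFun (volume.restrict (Ioi 0 \ S)) := by
    refine (aestronglyMeasurable_const (b := ζ.toFun 0)).congr ?_
    filter_upwards [ae_restrict_mem (measurableSet_Ioi.diff hSm)] with x hx
    rw [ζ.absCont x (le_of_lt hx.1), intervalIntegral.integral_undef, add_zero]
    exact fun h => hx.2 ⟨le_of_lt hx.1, h⟩
  have h3 := aestronglyMeasurable_union_iff.mpr ⟨h1, h2⟩
  exact h3.mono_measure (Measure.restrict_mono (fun x hx => by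
    by_cases hs : x ∈ S
    · exact Or.inl hs
    · exact Or.inr ⟨hx, hs⟩) le_rfl)

lemma H1K.aesm' (ζ : H1K) (hg : ∀ X, 0 ≤ X → IntervalIntegrable ζ.deriv' volume 0 X) :
    AEStronglyMeasurable ζ.deriv' (volume.restrict (Ioi (0:ℝ))) := by
  have : Ioi (0:ℝ) = ⋃ n : ℕ, Ioc 0 (n:ℝ) := by
    ext x
    simp only [mem_Ioi, mem_iUnion, mem_Ioc]
    constructor
    · intro h
      obtain ⟨n, hn⟩ := exists_nat_ge x
      exact ⟨n, h, hn⟩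
    · rintro ⟨n, h, _⟩; exact h
  rw [this, aestronglyMeasurable_iUnion_iff]
  intro n
  exact (hg n (Nat.cast_nonneg n)).1.aestronglyMeasurable

lemma H1K.good_of_aesm (ζ : H1K) (h : AEStronglyMeasurable ζ.deriv' (volume.restrict (Ioi (0:ℝ))))
    (X : ℝ) (hX : 0 ≤ X) : IntervalIntegrable ζ.deriv' volume 0 X := by
  rw [intervalIntegrable_iff_integrableOn_Ioc_of_le hX]
  have h1 : IntegrableOn (fun η => (ζ.deriv' η) ^ 2 * Kw η) (Ioc 0 X) :=
    IntegrableOn.mono_set ζ.derivMemL2 Ioc_subset_Ioi_self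
  have h2 : IntegrableOn (fun _ : ℝ => (1:ℝ)) (Ioc 0 X) := integrableOn_const (hs := measure_Ioc_lt_top.ne)
  refine Integrable.mono' (h2.add h1)
    (h.mono_measure (Measure.restrict_mono Ioc_subset_Ioi_self le_rfl)) ?_
  refine Eventually.of_forall fun x => ?_
  simp only [Pi.add_apply]
  rw [Real.norm_eq_abs]
  have a1 := Kw_one_le x
  have a2 := sq_nonneg (|ζ.deriv' x| - 1)
  have a3 := sq_abs (ζ.deriv' x)
  nlinarith [sq_nonneg (ζ.deriv' x), abs_nonneg (ζ.deriv' x)]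

lemma mulK_integrable {f g : ℝ → ℝ} {μ : Measure ℝ} (hf : AEStronglyMeasurable f μ)
    (hg : AEStronglyMeasurable g μ) (hf2 : Integrable (fun x => f x ^ 2 * Kw x) μ)
    (hg2 : Integrable (fun x => g x ^ 2 * Kw x) μ) : Integrable (fun x => f x * g x * Kw x) μ := by
  refine Integrable.mono' (hf2.add hg2) ((hf.mul hg).mul Kw_continuous.aestronglyMeasurable) ?_
  refine Eventually.of_forall fun x => ?_
  simp only [Pi.add_apply]
  rw [Real.norm_eq_abs, abs_mul, abs_mul, abs_of_pos (Kw_pos x), ← sq_abs (f x), ← sq_abs (g x)]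
  have := Kw_pos x
  have h : |f x| * |g x| ≤ |f x| ^ 2 + |g x| ^ 2 := by
    nlinarith [sq_nonneg (|f x| - |g x|), sq_nonneg (|f x| + |g x|)]
  nlinarith

lemma DecSol.contψ {l : ℝ} {ψ F : ℝ → ℝ} (hD : DecSol l ψ F) : Continuous ψ :=
  continuous_iff_continuousAt.mpr fun x => (hD.der x).continuousAt

lemma DecSol.contF {l : ℝ} {ψ F : ℝ → ℝ} (hD : DecSol l ψ F) : Continuous F :=
  continuous_iff_continuousAt.mpr fun x => (hD.derF x).continuousAt

lemma DecSol.contFK {l : ℝ} {ψ F : ℝ → ℝ} (hD : DecSol l ψ F) : Continuous (fun x => F x / Kw x) :=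
  hD.contF.div Kw_continuous fun x => (Kw_pos x).ne'

lemma DecSol.identity {l : ℝ} {ψ F : ℝ → ℝ} (hD : DecSol l ψ F) (ζ : H1K)
    (hg : ∀ X, 0 ≤ X → IntervalIntegrable ζ.deriv' volume 0 X) :
    ∫ x in Ioi (0:ℝ), (F x / Kw x * ζ.deriv' x - l * (ψ x * ζ.toFun x)) * Kw x
      = - (F 0 * ζ.toFun 0) := by
  have hm := ζ.aesm
  have hm' := ζ.aesm' hg
  have i1 := mulK_integrable hD.contFK.aestronglyMeasurable hm' hD.memF ζ.derivMemL2
  have i2 := mulK_integrable hD.contψ.aestronglyMeasurable hm hD.mem ζ.memL2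
  have i3 := mulK_integrable hD.contFK.aestronglyMeasurable hm hD.memF ζ.memL2
  have hΦ : IntegrableOn (fun x => (F x / Kw x * ζ.deriv' x - l * (ψ x * ζ.toFun x)) * Kw x)
      (Ioi 0) := by
    refine (i1.sub (i2.const_mul l)).congr (Eventually.of_forall fun x => ?_)
    simp only [Pi.sub_apply]
    ring
  have hI : ∀ X, 0 ≤ X → ∫ x in (0:ℝ)..X,
      (F x / Kw x * ζ.deriv' x - l * (ψ x * ζ.toFun x)) * Kw x = F X * ζ.toFun X - F 0 * ζ.toFun 0 := by
    intro X hX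
    have hcd : Continuous (fun x => -(l * (ψ x * Kw x))) := by
      have := hD.contψ; have := Kw_continuous; fun_prop
    rw [← ibp (u := fun x => -(l * (ψ x * Kw x))) (v := ζ.deriv') (A := F) (B := ζ.toFun) hX
      (hcd.intervalIntegrable _ _) (hg X hX) (fun x hx => ?_) (fun x hx => ζ.absCont x hx.1)]
    · apply intervalIntegral.integral_congr
      intro x _
      have := (Kw_pos x).ne'
      simp only
      field_simp
      ring
    · rw [intervalIntegral.integral_eq_sub_of_hasDerivAt (fun y _ => hD.derF y)
        (hcd.intervalIntegrable _ _)]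
      ring
  have ht := intervalIntegral_tendsto_integral_Ioi 0 hΦ tendsto_id
  set L := ∫ x in Ioi (0:ℝ), (F x / Kw x * ζ.deriv' x - l * (ψ x * ζ.toFun x)) * Kw x with hL
  have ht2 : Tendsto (fun X => F X / Kw X * ζ.toFun X * Kw X) atTop (𝓝 (L + F 0 * ζ.toFun 0)) := by
    refine (ht.add_const (F 0 * ζ.toFun 0)).congr' ?_
    filter_upwards [eventually_ge_atTop 0] with X hX
    have := (Kw_pos X).ne'
    simp only [id]
    rw [hI X hX]
    field_simp
    ring
  have h0 := IntegrableAtFilter.eq_zero_of_tendsto (μ := volume) (l := atTop)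
    ⟨Ioi 0, Ioi_mem_atTop 0, i3⟩ (fun s hs => by
      obtain ⟨b, hb⟩ := mem_atTop_sets.mp hs
      rw [← top_le_iff, ← Real.volume_Ici (a := b)]
      exact measure_mono hb) ht2
  linarith

lemma local_flux {l β : ℝ} (ω : H1K)
    (hw : ∀ ζ : H1K, (∫ x in Ioi (0:ℝ), (ω.deriv' x * ζ.deriv' x - l * (ω.toFun x * ζ.toFun x)) * Kw x)
      + β * ζ.toFun 0 = 0) {X : ℝ} (hX : 0 ≤ X) (hi : IntervalIntegrable ω.deriv' volume 0 X) :
    ∃ w Fw : ℝ → ℝ, (∀ x ∈ Icc 0 X, w x = ω.toFun x) ∧ Fw 0 = β ∧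
      (∀ x, HasDerivAt w (Fw x / Kw x) x) ∧
      (∀ x ∈ Icc 0 X, HasDerivAt Fw (-(l * (w x * Kw x))) x) := by
  have hK := Kw_continuous
  have hui : Integrable ((Ioc 0 X).indicator ω.deriv') volume :=
    ((intervalIntegrable_iff_integrableOn_Ioc_of_le hX).mp hi).integrable_indicator measurableSet_Ioc
  obtain ⟨q, hq⟩ : ∃ q : ℝ → ℝ, q = fun x => ω.toFun 0 + ∫ t in (0:ℝ)..x, (Ioc 0 X).indicator ω.deriv' t :=
    ⟨_, rfl⟩
  have qc : Continuous q := by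
    rw [hq]
    exact continuous_const.add (intervalIntegral.continuous_primitive (fun a b => hui.intervalIntegrable) 0)
  have qω : ∀ x ∈ Icc 0 X, q x = ω.toFun x := by
    intro x hx
    rw [hq, ω.absCont x hx.1]
    simp only
    congr 1
    apply intervalIntegral.integral_congr_ae
    refine Eventually.of_forall fun t ht => ?_
    rw [uIoc_of_le hx.1] at ht
    rw [indicator_of_mem]
    exact ⟨ht.1, ht.2.trans hx.2⟩
  obtain ⟨G, hG⟩ : ∃ G : ℝ → ℝ, G = fun x => ∫ t in (0:ℝ)..x, q t * Kw t := ⟨_, rfl⟩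
  have dG : ∀ x, HasDerivAt G (q x * Kw x) x := fun x => by
    rw [hG]
    exact (qc.mul hK).integral_hasStrictDerivAt 0 x |>.hasDerivAt
  have Gc : Continuous G := continuous_iff_continuousAt.mpr fun x => (dG x).continuousAt
  have G0 : G 0 = 0 := by rw [hG]; simp
  obtain ⟨Fw, hFw⟩ : ∃ Fw : ℝ → ℝ, Fw = fun x => β - l * G x := ⟨_, rfl⟩
  have Fc : Continuous Fw := by rw [hFw]; fun_prop
  obtain ⟨d, hd⟩ : ∃ d : ℝ → ℝ, d = fun x => Kw x * ω.deriv' x - Fw x := ⟨_, rfl⟩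
  -- integrability facts
  have isq : IntervalIntegrable (fun x => ω.deriv' x ^ 2 * Kw x) volume 0 X := by
    rw [intervalIntegrable_iff_integrableOn_Ioc_of_le hX]
    exact IntegrableOn.mono_set ω.derivMemL2 Ioc_subset_Ioi_self
  have id1 : IntervalIntegrable d volume 0 X := by
    rw [hd]
    exact (hi.continuousOn_mul hK.continuousOn).sub (Fc.intervalIntegrable _ _)
  have id2 : IntervalIntegrable (fun x => d x ^ 2) volume 0 X := by
    have h := ((isq.continuousOn_mul hK.continuousOn).sub
      (hi.continuousOn_mul (g := fun x => 2 * Kw x * Fw x) (by fun_prop))).add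
      ((Fc.pow 2).intervalIntegrable (μ := volume) 0 X)
    refine h.congr fun x _ => ?_
    rw [hd]; simp only [Pi.pow_apply]; ring
  have id3 : IntervalIntegrable (fun x => d x ^ 2 * Kw x) volume 0 X :=
    id2.mul_continuousOn hK.continuousOn
  have id4 : IntervalIntegrable (fun x => ω.deriv' x * d x * Kw x) volume 0 X := by
    have h := (isq.continuousOn_mul hK.continuousOn).sub
      (hi.continuousOn_mul (g := fun x => Kw x * Fw x) (by fun_prop))
    refine h.congr fun x _ => ?_
    rw [hd]; simp only []; ring
  have id5 : IntervalIntegrable (fun x => G x * d x) volume 0 X :=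
    id1.continuousOn_mul Gc.continuousOn
  obtain ⟨g, hg⟩ : ∃ g : ℝ → ℝ, g = (Ioc 0 X).indicator d := ⟨_, rfl⟩
  have gd : ∀ x ∈ Ioc 0 X, g x = d x := fun x hx => by rw [hg, indicator_of_mem hx]
  have g0 : ∀ x, X < x → g x = 0 := fun x hx => by
    rw [hg, indicator_of_notMem]; exact fun h => absurd h.2 (not_le.mpr hx)
  have gi : Integrable g volume := by
    rw [hg]
    exact ((intervalIntegrable_iff_integrableOn_Ioc_of_le hX).mp id1).integrable_indicator measurableSet_Ioc
  have gii : ∀ a b : ℝ, IntervalIntegrable g volume a b := fun a b => gi.intervalIntegrable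
  obtain ⟨z, hz⟩ : ∃ z : ℝ → ℝ, z = fun x => (∫ t in (0:ℝ)..X, g t) - ∫ t in (0:ℝ)..x, g t := ⟨_, rfl⟩
  have zc : Continuous z := by
    rw [hz]
    exact continuous_const.sub (intervalIntegral.continuous_primitive gii 0)
  have zX : z X = 0 := by rw [hz]; simp
  have z0 : z 0 = ∫ t in (0:ℝ)..X, d t := by
    rw [hz]; simp only [intervalIntegral.integral_same, sub_zero]
    apply intervalIntegral.integral_congr_ae
    refine Eventually.of_forall fun t ht => ?_
    rw [uIoc_of_le hX] at ht
    exact gd t ht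
  have zbig : ∀ x, X < x → z x = 0 := fun x hx => by
    rw [hz]
    simp only
    rw [← intervalIntegral.integral_add_adjacent_intervals (gii 0 X) (gii X x)]
    have : ∫ t in X..x, g t = 0 := by
      apply intervalIntegral.integral_zero_ae
      refine Eventually.of_forall fun t ht => ?_
      rw [uIoc_of_le hx.le] at ht
      exact g0 t ht.1
    rw [this]; ring
  have hun : Ioi (0:ℝ) = Ioc 0 X ∪ Ioi X := (Ioc_union_Ioi_eq_Ioi hX).symm
  let ζ : H1K :=
    { toFun := z
      deriv' := fun x => -g x
      absCont := by
        intro x hx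
        rw [intervalIntegral.integral_neg, hz]
        simp only [intervalIntegral.integral_same]
        ring
      memL2 := by
        change IntegrableOn _ (Ioi 0) volume
        rw [hun]
        refine IntegrableOn.union ?_ ?_
        · exact (((zc.pow 2).mul hK).integrableOn_Icc (a := 0) (b := X)).mono_set Ioc_subset_Icc_self
        · refine integrableOn_zero.congr_fun (fun x hx => ?_) measurableSet_Ioi
          simp only
          rw [zbig x hx]; simp
      derivMemL2 := by
        change IntegrableOn _ (Ioi 0) volume
        rw [hun]
        refine IntegrableOn.union ?_ ?_
        · refine ((intervalIntegrable_iff_integrableOn_Ioc_of_le hX).mp id3).congr_fun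
            (fun x hx => ?_) measurableSet_Ioc
          simp only
          rw [gd x hx]; ring
        · refine integrableOn_zero.congr_fun (fun x hx => ?_) measurableSet_Ioi
          simp only
          rw [g0 x hx]; simp }
  have hwz := hw ζ
  have hE1 : (∫ x in Ioi (0:ℝ), (ω.deriv' x * ζ.deriv' x - l * (ω.toFun x * ζ.toFun x)) * Kw x)
      = ∫ x in (0:ℝ)..X, (-(ω.deriv' x * d x * Kw x) - l * (q x * Kw x * z x)) := by
    rw [intervalIntegral.integral_of_le hX, setIntegral_eq_of_subset_of_forall_sdiff_eq_zero
      measurableSet_Ioi (show Ioc 0 X ⊆ Ioi (0:ℝ) from Ioc_subset_Ioi_self)]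
    · refine setIntegral_congr_fun measurableSet_Ioc fun x hx => ?_
      simp only [ζ]
      rw [gd x hx, qω x ⟨hx.1.le, hx.2⟩]
      ring
    · intro x hx
      have : X < x := by
        by_contra h
        exact hx.2 ⟨hx.1, not_lt.mp h⟩
      simp only [ζ]
      rw [g0 x this, zbig x this]
      ring
  have hE2 : ∫ x in (0:ℝ)..X, (q x * Kw x * z x - G x * d x) = 0 := by
    have h := ibp (u := fun x => q x * Kw x) (v := fun x => -g x) (A := G) (B := z) hX
      ((qc.mul hK).intervalIntegrable _ _) (gii 0 X).neg
      (fun x hx => by rw [G0, hG]; simp) (fun x hx => ζ.absCont x hx.1)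
    rw [zX, G0] at h
    simp only [mul_zero, zero_mul, sub_zero] at h
    refine Eq.trans ?_ h
    apply intervalIntegral.integral_congr_ae
    refine Eventually.of_forall fun t ht => ?_
    rw [uIoc_of_le hX] at ht
    rw [gd t ht]; ring
  have iz : IntervalIntegrable (fun x => q x * Kw x * z x) volume 0 X :=
    ((qc.mul hK).mul zc).intervalIntegrable _ _
  have hsum : ∫ x in (0:ℝ)..X, d x ^ 2 = 0 := by
    have e : ∀ x, d x ^ 2 = -((-(ω.deriv' x * d x * Kw x) - l * (q x * Kw x * z x))
        + l * (q x * Kw x * z x - G x * d x) + β * d x) := by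
      intro x
      have : d x ^ 2 = d x * (Kw x * ω.deriv' x - (β - l * G x)) := by
        rw [sq]; nth_rewrite 2 [hd]; rw [hFw]
      rw [this]; ring
    rw [intervalIntegral.integral_congr fun x _ => e x, intervalIntegral.integral_neg,
      intervalIntegral.integral_add, intervalIntegral.integral_add, ← hE1,
      intervalIntegral.integral_const_mul, intervalIntegral.integral_const_mul, hE2, ← z0]
    · have : ζ.toFun 0 = z 0 := rfl
      rw [this] at hwz
      linarith
    · exact id4.neg.sub (iz.const_mul l)
    · exact (iz.sub id5).const_mul l
    · exact (id4.neg.sub (iz.const_mul l)).add ((iz.sub id5).const_mul l)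
    · exact id1.const_mul β
  have hae : ∀ᵐ x ∂(volume.restrict (Ioc 0 X)), d x = 0 := by
    rw [intervalIntegral.integral_of_le hX, integral_eq_zero_iff_of_nonneg (fun x => sq_nonneg _)
      ((intervalIntegrable_iff_integrableOn_Ioc_of_le hX).mp id2)] at hsum
    filter_upwards [hsum] with x hx
    simpa using hx
  have cFK : Continuous (fun x => Fw x / Kw x) := Fc.div hK fun x => (Kw_pos x).ne'
  have hwω : ∀ x ∈ Icc 0 X, ω.toFun 0 + ∫ t in (0:ℝ)..x, Fw t / Kw t = ω.toFun x := by
    intro x hx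
    rw [ω.absCont x hx.1]
    congr 1
    apply intervalIntegral.integral_congr_ae
    rw [ae_restrict_iff' measurableSet_Ioc] at hae
    filter_upwards [hae] with t ht hxt
    rw [uIoc_of_le hx.1] at hxt
    have h1 := ht ⟨hxt.1, hxt.2.trans hx.2⟩
    rw [hd] at h1
    simp only at h1
    rw [div_eq_iff (Kw_pos t).ne']
    linarith
  refine ⟨fun x => ω.toFun 0 + ∫ t in (0:ℝ)..x, Fw t / Kw t, Fw, hwω, ?_, ?_, ?_⟩
  · rw [hFw]; simp [G0]
  · intro x
    exact (cFK.integral_hasStrictDerivAt 0 x).hasDerivAt.const_add _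
  · intro x hx
    beta_reduce
    rw [hwω x hx, ← qω x hx, hFw]
    exact ((dG x).const_mul l).const_sub β

lemma local_unique {l β : ℝ} {ψ F : ℝ → ℝ} (hD : DecSol l ψ F) (ω : H1K)
    (hw : ∀ ζ : H1K, (∫ x in Ioi (0:ℝ), (ω.deriv' x * ζ.deriv' x - l * (ω.toFun x * ζ.toFun x)) * Kw x)
      + β * ζ.toFun 0 = 0) (h0 : β * ψ 0 = F 0 * ω.toFun 0)
    {X : ℝ} (hX : 0 ≤ X) (hi : IntervalIntegrable ω.deriv' volume 0 X) :
    ω.toFun X = ω.toFun 0 / ψ 0 * ψ X := by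
  obtain ⟨w, Fw, hwω, hF0, dw, dF⟩ := local_flux ω hw hX hi
  have dD : ∀ x ∈ Icc 0 X, HasDerivAt (fun x => Fw x * ψ x - F x * w x) 0 x := by
    intro x hx
    refine HasDerivAt.congr_deriv (((dF x hx).mul (hD.der x)).sub ((hD.derF x).mul (dw x))) ?_
    ring
  have w0 := hwω 0 ⟨le_rfl, hX⟩
  have hD0 : ∀ x ∈ Icc 0 X, Fw x * ψ x - F x * w x = 0 := by
    intro x hx
    have := constant_of_has_deriv_right_zero (f := fun x => Fw x * ψ x - F x * w x)
      (fun x hx => (dD x hx).continuousAt.continuousWithinAt)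
      (fun x hx => (dD x ⟨hx.1, hx.2.le⟩).hasDerivWithinAt) x hx
    rw [this, hF0, w0, h0]; ring
  have dq : ∀ x ∈ Icc 0 X, HasDerivAt (fun x => w x / ψ x) 0 x := by
    intro x hx
    refine HasDerivAt.congr_deriv ((dw x).div (hD.der x) (hD.pos x hx.1).ne') ?_
    have h1 := hD0 x hx
    have h2 := (Kw_pos x).ne'
    have h3 := (hD.pos x hx.1).ne'
    field_simp
    linarith
  have := constant_of_has_deriv_right_zero (f := fun x => w x / ψ x)
      (fun x hx => (dq x hx).continuousAt.continuousWithinAt)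
      (fun x hx => (dq x ⟨hx.1, hx.2.le⟩).hasDerivWithinAt) X ⟨hX, le_rfl⟩
  rw [w0, hwω X ⟨hX, le_rfl⟩, div_eq_iff (hD.pos X hX).ne'] at this
  exact this

/-- The multiple `c ψ` as an element of the weighted Sobolev space. -/
noncomputable def DecSol.toH1K {l : ℝ} {ψ F : ℝ → ℝ} (hD : DecSol l ψ F) (c : ℝ) : H1K where
  toFun := fun x => c * ψ x
  deriv' := fun x => c * (F x / Kw x)
  absCont := by
    intro x _
    rw [intervalIntegral.integral_const_mul, intervalIntegral.integral_eq_sub_of_hasDerivAt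
      (fun y _ => hD.der y) (hD.contFK.intervalIntegrable _ _)]
    ring
  memL2 := by
    refine (hD.mem.const_mul (c ^ 2)).congr (Eventually.of_forall fun x => ?_)
    simp only; ring
  derivMemL2 := by
    refine (hD.memF.const_mul (c ^ 2)).congr (Eventually.of_forall fun x => ?_)
    simp only; ring

lemma DecSol.F_ne_ae {l : ℝ} {ψ F : ℝ → ℝ} (hD : DecSol l ψ F) (hl : 0 < l) :
    ∀ᵐ x ∂(volume.restrict (Ioi (0:ℝ))), F x ≠ 0 := by
  have hs : StrictAntiOn F (Ici 0) := by
    refine strictAntiOn_of_deriv_neg (convex_Ici 0) hD.contF.continuousOn fun x hx => ?_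
    rw [interior_Ici] at hx
    rw [(hD.derF x).deriv]
    have := mul_pos hl (mul_pos (hD.pos x (le_of_lt hx)) (Kw_pos x))
    linarith
  rw [ae_restrict_iff' measurableSet_Ioi]
  have hsub : ({x : ℝ | 0 < x ∧ F x = 0}).Subsingleton := by
    intro x hx y hy
    exact hs.injOn (le_of_lt hx.1) (le_of_lt hy.1) (hx.2.trans hy.2.symm)
  rw [ae_iff]
  refine measure_mono_null ?_ (hsub.measure_zero volume)
  intro x hx
  simp only [mem_ofPred_eq, not_forall, not_not] at hx
  obtain ⟨h1, h2⟩ := hx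
  exact ⟨h1, h2⟩

lemma DecSol.weak {l : ℝ} {ψ F : ℝ → ℝ} (hD : DecSol l ψ F) (hl : 0 < l) (c : ℝ) (ζ : H1K) :
    ∫ x in Ioi (0:ℝ), ((hD.toH1K c).deriv' x * ζ.deriv' x - l * ((hD.toH1K c).toFun x * ζ.toFun x)) * Kw x
      = - (c * F 0 * ζ.toFun 0) := by
  by_cases hc : c = 0
  · subst hc
    simp [DecSol.toH1K]
  have e : (fun x => ((hD.toH1K c).deriv' x * ζ.deriv' x - l * ((hD.toH1K c).toFun x * ζ.toFun x)) * Kw x)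
      = fun x => c * ((F x / Kw x * ζ.deriv' x - l * (ψ x * ζ.toFun x)) * Kw x) := by
    funext x; simp only [DecSol.toH1K]; ring
  rw [e, integral_const_mul]
  by_cases hg : ∀ X, 0 ≤ X → IntervalIntegrable ζ.deriv' volume 0 X
  · rw [hD.identity ζ hg]; ring
  have hz : ζ.toFun 0 = 0 := ζ.good_or.resolve_left hg
  rw [hz, integral_undef]
  · simp
  intro hint
  apply hg
  apply ζ.good_of_aesm
  have h1 : AEStronglyMeasurable (fun x => ((F x / Kw x * ζ.deriv' x - l * (ψ x * ζ.toFun x)) * Kw x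
      + l * (ψ x * ζ.toFun x) * Kw x) * (F x)⁻¹) (volume.restrict (Ioi (0:ℝ))) := by
    refine (hint.aestronglyMeasurable.add ?_).mul ?_
    · exact ((hD.contψ.aestronglyMeasurable.mul ζ.aesm).const_mul l).mul Kw_continuous.aestronglyMeasurable
    · exact hD.contF.measurable.inv.aestronglyMeasurable
  refine h1.congr ?_
  filter_upwards [hD.F_ne_ae hl] with x hx
  have := (Kw_pos x).ne'
  field_simp
  ring

lemma weak_eq {p : ℝ} (ω ζ : H1K) :
    (∫ η in Ioi (0:ℝ),
        (ω.deriv' η * ζ.deriv' η - ω.toFun η * ζ.toFun η / (2 * (p - 1))) * Kw η)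
    = ∫ x in Ioi (0:ℝ), (ω.deriv' x * ζ.deriv' x - 1 / (2 * (p - 1)) * (ω.toFun x * ζ.toFun x)) * Kw x := by
  congr 1; funext x; ring

lemma weak_classify {p : ℝ} {ψ F : ℝ → ℝ} (hD : DecSol (1 / (2 * (p - 1))) ψ F)
    (ω : H1K) (hω : IsWeakProfile p ω) :
    |ω.toFun 0| ^ (p - 1) * ω.toFun 0 * ψ 0 = F 0 * ω.toFun 0 ∧
    ∀ x, 0 ≤ x → ω.toFun x = ω.toFun 0 / ψ 0 * ψ x := by
  have hw : ∀ ζ : H1K, (∫ x in Ioi (0:ℝ), (ω.deriv' x * ζ.deriv' x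
      - 1 / (2 * (p - 1)) * (ω.toFun x * ζ.toFun x)) * Kw x)
      + |ω.toFun 0| ^ (p - 1) * ω.toFun 0 * ζ.toFun 0 = 0 := by
    intro ζ
    rw [← weak_eq]
    exact hω ζ
  have h0 : |ω.toFun 0| ^ (p - 1) * ω.toFun 0 * ψ 0 = F 0 * ω.toFun 0 := by
    rcases ω.good_or with hg | hz
    · have h1 := hw (hD.toH1K 1)
      have h2 := hD.identity ω hg
      have e : ∫ x in Ioi (0:ℝ), (ω.deriv' x * (hD.toH1K 1).deriv' x
          - 1 / (2 * (p - 1)) * (ω.toFun x * (hD.toH1K 1).toFun x)) * Kw x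
          = ∫ x in Ioi (0:ℝ), (F x / Kw x * ω.deriv' x - 1 / (2 * (p - 1)) * (ψ x * ω.toFun x)) * Kw x := by
        congr 1; funext x; simp only [DecSol.toH1K]; ring
      rw [e, h2] at h1
      simp only [DecSol.toH1K, one_mul] at h1
      linarith
    · rw [hz]; simp
  refine ⟨h0, fun x hx => ?_⟩
  by_cases hi : IntervalIntegrable ω.deriv' volume 0 x
  · exact local_unique hD ω hw h0 hx hi
  · have hz : ω.toFun 0 = 0 := ω.good_or.resolve_left fun h => hi (h x hx)
    rw [ω.absCont x hx, intervalIntegral.integral_undef hi, hz]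
    simp

theorem profile_structure_of_p_between (p : ℝ) (hp1 : 3 / 2 < p) (hp2 : p < 2) :
    ∃ ωs : H1K, IsWeakProfile p ωs ∧ (∀ η : ℝ, 0 ≤ η → 0 < ωs.toFun η) ∧
      (∀ ω : H1K, IsWeakProfile p ω → (∀ η : ℝ, 0 ≤ η → 0 < ω.toFun η) →
        ∀ᵐ η ∂(volume.restrict (Ioi (0:ℝ))), ω.toFun η = ωs.toFun η) ∧
      (∀ ω : H1K, IsWeakProfile p ω →
        (∀ᵐ η ∂(volume.restrict (Ioi (0:ℝ))), ω.toFun η = ωs.toFun η) ∨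
        (∀ᵐ η ∂(volume.restrict (Ioi (0:ℝ))), ω.toFun η = - ωs.toFun η) ∨
        (∀ᵐ η ∂(volume.restrict (Ioi (0:ℝ))), ω.toFun η = 0)) := by
  have hp : 0 < p - 1 := by linarith
  have hl1 : 1 / 2 < 1 / (2 * (p - 1)) := by
    rw [div_lt_div_iff₀ (by norm_num) (by linarith)]; linarith
  have hl2 : 1 / (2 * (p - 1)) < 1 := by
    rw [div_lt_one (by linarith)]; linarith
  obtain ⟨ψ, F, hD⟩ := exists_decSol hl1 hl2
  have hψ := hD.pos 0 le_rfl
  have hF := hD.F0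
  obtain ⟨α, hα⟩ : ∃ α : ℝ, α = (F 0 / ψ 0) ^ (1 / (p - 1)) := ⟨_, rfl⟩
  have hα0 : 0 < α := by rw [hα]; exact Real.rpow_pos_of_pos (div_pos hF hψ) _
  have hαp : α ^ (p - 1) = F 0 / ψ 0 := by
    rw [hα, ← Real.rpow_mul (div_pos hF hψ).le, one_div_mul_cancel hp.ne', Real.rpow_one]
  have habs : ∀ ω : H1K, IsWeakProfile p ω → ω.toFun 0 ≠ 0 → |ω.toFun 0| = α := by
    intro ω hω hne
    have h1 := (weak_classify hD ω hω).1
    have h2 : |ω.toFun 0| ^ (p - 1) = F 0 / ψ 0 := by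
      rw [eq_div_iff hψ.ne']
      apply mul_right_cancel₀ hne
      linarith
    rw [hα, ← h2, ← Real.rpow_mul (abs_nonneg _), mul_one_div_cancel hp.ne', Real.rpow_one]
  have hval : ∀ x, (hD.toH1K (α / ψ 0)).toFun x = α / ψ 0 * ψ x := fun x => rfl
  refine ⟨hD.toH1K (α / ψ 0), ?_, ?_, ?_, ?_⟩
  · intro ζ
    rw [weak_eq, hD.weak (by linarith), hval, div_mul_cancel₀ _ hψ.ne', abs_of_pos hα0, hαp]
    ring
  · intro x hx
    rw [hval]
    exact mul_pos (div_pos hα0 hψ) (hD.pos x hx)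
  · intro ω hω hpos
    have h1 := hpos 0 le_rfl
    have h2 := habs ω hω h1.ne'
    rw [abs_of_pos h1] at h2
    filter_upwards [ae_restrict_mem measurableSet_Ioi] with x hx
    rw [(weak_classify hD ω hω).2 x (le_of_lt hx), hval, h2]
  · intro ω hω
    have hc := (weak_classify hD ω hω).2
    rcases lt_trichotomy (ω.toFun 0) 0 with h | h | h
    · right; left
      have h2 := habs ω hω h.ne
      rw [abs_of_neg h] at h2
      filter_upwards [ae_restrict_mem measurableSet_Ioi] with x hx
      rw [hc x (le_of_lt hx), hval, ← h2]; ring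
    · right; right
      filter_upwards [ae_restrict_mem measurableSet_Ioi] with x hx
      rw [hc x (le_of_lt hx), h]; simp
    · left
      have h2 := habs ω hω h.ne'
      rw [abs_of_pos h] at h2
      filter_upwards [ae_restrict_mem measurableSet_Ioi] with x hx
      rw [hc x (le_of_lt hx), hval, h2]
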